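/- arXiv:1409.0131 — 3 statements merged into one kernel-verified Lean document; each statement's English description precedes it below -/
import Mathlib

section
/- For n = 3, the kernel of the homomorphism π : J_3 → S_3 (the pure cactus group PJ_3) is an infinite cyclic group; more precisely, it is generated by the element (s_{1,3}·s_{1,2})³, which has infinite order in J_3. -/
/-- The underlying function of the segment reversal `r_{p,q}`: in the 1-based labels
carried by `Fin n` (where `i : Fin n` represents the number `i + 1`), it sends
`i ↦ p + q - i` for `p ≤ i ≤ q` (provided `1 ≤ p` and `q ≤ n`) and fixes all other
points. -/
def segRevFun (n p q : ℕ) : Fin n → Fin n := fun i =>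
  if h : 1 ≤ p ∧ p ≤ (i : ℕ) + 1 ∧ (i : ℕ) + 1 ≤ q ∧ q ≤ n
    then ⟨p + q - ((i : ℕ) + 2), by omega⟩ else i

lemma segRevFun_involutive (n p q : ℕ) : Function.Involutive (segRevFun n p q) := by
  intro i
  apply Fin.ext
  simp only [segRevFun]
  split_ifs <;> simp only [Fin.val_mk] at * <;> omega

/-- The permutation `r_{p,q}` of `{1,…,n}` reversing the segment `[p, q]`. -/
def segRev (n p q : ℕ) : Equiv.Perm (Fin n) :=
  (segRevFun_involutive n p q).toPerm

/-- Index type for the generators `s_{p,q}`, `1 ≤ p < q ≤ n`, of the cactus group `J_n`. -/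
def CactusGen (n : ℕ) : Type :=
  {pq : ℕ × ℕ // 1 ≤ pq.1 ∧ pq.1 < pq.2 ∧ pq.2 ≤ n}

/-- The defining relations of the cactus group `J_n`:
(1) `s_{p,q}² = e`;
(2) `s_{p₁,q₁} s_{p₂,q₂} = s_{p₂,q₂} s_{p₁,q₁}` whenever `q₁ < p₂`;
(3) `s_{p₁,q₁} s_{p₂,q₂} s_{p₁,q₁} = s_{p₁+q₁−q₂, p₁+q₁−p₂}` whenever `p₁ ≤ p₂ < q₂ ≤ q₁`. -/
def cactusRels (n : ℕ) : Set (FreeGroup (CactusGen n)) :=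
  {w | ∃ g : CactusGen n, w = FreeGroup.of g * FreeGroup.of g} ∪
  {w | ∃ g₁ g₂ : CactusGen n, g₁.1.2 < g₂.1.1 ∧
      w = FreeGroup.of g₁ * FreeGroup.of g₂ * (FreeGroup.of g₂ * FreeGroup.of g₁)⁻¹} ∪
  {w | ∃ g₁ g₂ g₃ : CactusGen n, g₁.1.1 ≤ g₂.1.1 ∧ g₂.1.2 ≤ g₁.1.2 ∧
      g₃.1.1 = g₁.1.1 + g₁.1.2 - g₂.1.2 ∧ g₃.1.2 = g₁.1.1 + g₁.1.2 - g₂.1.1 ∧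
      w = FreeGroup.of g₁ * FreeGroup.of g₂ * FreeGroup.of g₁ * (FreeGroup.of g₃)⁻¹}

/-- The cactus group `J_n`, presented by the generators `s_{p,q}` (for `1 ≤ p < q ≤ n`)
and the cactus relations. -/
def CactusGroup (n : ℕ) : Type := PresentedGroup (cactusRels n)

noncomputable instance (n : ℕ) : Group (CactusGroup n) := by
  unfold CactusGroup; infer_instance

/-- The generator `s_{p,q}` of the cactus group. -/
def cactusGen {n : ℕ} (g : CactusGen n) : CactusGroup n := PresentedGroup.of g

/-- The element `(s_{1,3} · s_{1,2})³` of the cactus group `J₃`. -/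
noncomputable def cactusLoop : CactusGroup 3 :=
  (cactusGen (⟨(1, 3), by decide⟩ : CactusGen 3) *
    cactusGen (⟨(1, 2), by decide⟩ : CactusGen 3)) ^ 3

/-- In a group, if `a` and `b` are involutions, then `a` inverts every power of `a * b`. -/
lemma mul_zpow_mul_of_involutions {G : Type*} [Group G] {a b : G} (ha : a * a = 1)
    (hb : b * b = 1) (k : ℤ) : a * (a * b) ^ k = (a * b) ^ (-k) * a := by
  have hconj : a * (a * b) * a⁻¹ = (a * b)⁻¹ := by
    rw [mul_inv_rev, ← mul_assoc, ha, one_mul, inv_eq_of_mul_eq_one_left hb]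
  rw [← mul_inv_eq_iff_eq_mul, ← conj_zpow, hconj, inv_zpow, zpow_neg]

/-- Every element of the subgroup generated by two involutions `a` and `b` is of the form
`(a * b) ^ k` or `(a * b) ^ k * a`. -/
lemma exists_zpow_of_mem_closure_involutions {G : Type*} [Group G] {a b : G} (ha : a * a = 1)
    (hb : b * b = 1) {x : G} (hx : x ∈ Subgroup.closure {a, b}) :
    ∃ k : ℤ, x = (a * b) ^ k ∨ x = (a * b) ^ k * a := by
  have hmove := mul_zpow_mul_of_involutions ha hb
  have hinv : a⁻¹ = a := inv_eq_of_mul_eq_one_left ha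
  induction hx using Subgroup.closure_induction with
  | mem x hx =>
    rcases hx with rfl | rfl
    · exact ⟨0, Or.inr (by simp)⟩
    · refine ⟨-1, Or.inr ?_⟩
      rw [← hmove, zpow_one, ← mul_assoc, ha, one_mul]
  | one => exact ⟨0, Or.inl (by simp)⟩
  | mul x y _ _ hx hy =>
    obtain ⟨k, rfl | rfl⟩ := hx <;> obtain ⟨l, rfl | rfl⟩ := hy
    · exact ⟨k + l, Or.inl (zpow_add _ _ _).symm⟩
    · exact ⟨k + l, Or.inr (by rw [zpow_add, mul_assoc])⟩
    · exact ⟨k + -l, Or.inr (by rw [mul_assoc, hmove, zpow_add, mul_assoc])⟩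
    · refine ⟨k + -l, Or.inl ?_⟩
      rw [mul_assoc, ← mul_assoc a, hmove, mul_assoc _ a a, ha, mul_one, zpow_add]
  | inv x _ hx =>
    obtain ⟨k, rfl | rfl⟩ := hx
    · exact ⟨-k, Or.inl (zpow_neg _ _).symm⟩
    · exact ⟨k, Or.inr (by rw [mul_inv_rev, hinv, ← zpow_neg, hmove, neg_neg])⟩

lemma cactusGen_mul_self {n : ℕ} (g : CactusGen n) : cactusGen g * cactusGen g = 1 :=
  PresentedGroup.one_of_mem (rels := cactusRels n) (Or.inl (Or.inl ⟨g, rfl⟩))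

lemma cactusGen_conj {n : ℕ} (g₁ g₂ g₃ : CactusGen n) (hp : g₁.1.1 ≤ g₂.1.1)
    (hq : g₂.1.2 ≤ g₁.1.2) (hp₃ : g₃.1.1 = g₁.1.1 + g₁.1.2 - g₂.1.2)
    (hq₃ : g₃.1.2 = g₁.1.1 + g₁.1.2 - g₂.1.1) :
    cactusGen g₁ * cactusGen g₂ * cactusGen g₁ = cactusGen g₃ :=
  mul_inv_eq_one.mp (PresentedGroup.one_of_mem (rels := cactusRels n)
    (Or.inr ⟨g₁, g₂, g₃, hp, hq, hp₃, hq₃, rfl⟩))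

lemma closure_range_cactusGen (n : ℕ) :
    Subgroup.closure (Set.range (cactusGen (n := n))) = ⊤ :=
  PresentedGroup.closure_range_of (cactusRels n)

/-- The group `J₃` is generated by `s_{1,3}` and `s_{1,2}`. -/
lemma closure_cactusGen_three :
    Subgroup.closure {cactusGen (⟨(1, 3), by decide⟩ : CactusGen 3),
      cactusGen (⟨(1, 2), by decide⟩ : CactusGen 3)} = ⊤ := by
  rw [eq_top_iff, ← closure_range_cactusGen, Subgroup.closure_le]
  have h₁₃ := Subgroup.subset_closure (Set.mem_insert
    (cactusGen (⟨(1, 3), by decide⟩ : CactusGen 3))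
    {cactusGen (⟨(1, 2), by decide⟩ : CactusGen 3)})
  have h₁₂ := Subgroup.subset_closure (Set.mem_insert_of_mem
    (cactusGen (⟨(1, 3), by decide⟩ : CactusGen 3))
    (Set.mem_singleton (cactusGen (⟨(1, 2), by decide⟩ : CactusGen 3))))
  rintro _ ⟨⟨⟨p, q⟩, hp, hpq, hq⟩, rfl⟩
  dsimp only at hp hpq hq
  obtain ⟨rfl, rfl⟩ | ⟨rfl, rfl⟩ | ⟨rfl, rfl⟩ :
      (p = 1 ∧ q = 3) ∨ (p = 1 ∧ q = 2) ∨ (p = 2 ∧ q = 3) := by omega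
  · exact h₁₃
  · exact h₁₂
  · rw [← cactusGen_conj ⟨(1, 3), by decide⟩ ⟨(1, 2), by decide⟩ ⟨(2, 3), hp, hpq, hq⟩
      (by decide) (by decide) rfl rfl]
    exact mul_mem (mul_mem h₁₃ h₁₂) h₁₃

/-- The homomorphism from `J₃` to the infinite dihedral group sending `s_{p,q}` to the
reflection `i ↦ p + q - i` of the integers. -/
lemma exists_cactus_three_hom_dihedral :
    ∃ f : CactusGroup 3 →* DihedralGroup 0,
      ∀ g : CactusGen 3, f (cactusGen g) = DihedralGroup.sr ((g.1.1 + g.1.2 : ℕ) : ZMod 0) := by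
  have hrels : ∀ w ∈ cactusRels 3, FreeGroup.lift (fun g : CactusGen 3 =>
      DihedralGroup.sr ((g.1.1 + g.1.2 : ℕ) : ZMod 0)) w = 1 := by
    rintro w ((⟨g, rfl⟩ | ⟨g₁, g₂, h, rfl⟩) | ⟨g₁, g₂, g₃, hp, hq, hp₃, hq₃, rfl⟩)
    · simp
    · have := g₁.2
      have := g₂.2
      omega
    · have h₂ := g₂.2
      have hsum : ((g₃.1.1 + g₃.1.2 : ℕ) : ZMod 0) = (g₁.1.1 + g₁.1.2 : ℕ) -
          ((g₂.1.1 + g₂.1.2 : ℕ) - (g₁.1.1 + g₁.1.2 : ℕ)) := by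
        change ((g₃.1.1 + g₃.1.2 : ℕ) : ℤ) = (g₁.1.1 + g₁.1.2 : ℕ) -
          ((g₂.1.1 + g₂.1.2 : ℕ) - (g₁.1.1 + g₁.1.2 : ℕ) : ℤ)
        omega
      rw [map_mul, map_mul, map_mul, map_inv, mul_inv_eq_one]
      simp only [FreeGroup.lift_apply_of, DihedralGroup.sr_mul_sr, DihedralGroup.r_mul_sr, hsum]
  exact ⟨PresentedGroup.toGroup hrels, fun g => PresentedGroup.toGroup.of hrels⟩

lemma not_isOfFinOrder_cactusLoop : ¬ IsOfFinOrder cactusLoop := by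
  obtain ⟨f, hf⟩ := exists_cactus_three_hom_dihedral
  intro h
  obtain ⟨n, hn, hpow⟩ := isOfFinOrder_iff_pow_eq_one.mp (f.isOfFinOrder h)
  have hloop : f cactusLoop = (DihedralGroup.sr ((1 + 3 : ℕ) : ZMod 0) *
      DihedralGroup.sr ((1 + 2 : ℕ) : ZMod 0)) ^ 3 := by
    rw [cactusLoop, map_pow, map_mul]
    exact congrArg (· ^ 3) (congrArg₂ (· * ·) (hf _) (hf _))
  rw [hloop, DihedralGroup.sr_mul_sr, ← pow_mul, DihedralGroup.r_pow, DihedralGroup.one_def,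
    DihedralGroup.r.injEq] at hpow
  change (((1 + 2 : ℕ) : ℤ) - (1 + 3 : ℕ)) * ((3 * n : ℕ) : ℤ) = 0 at hpow
  omega

/-- The pure cactus group `PJ₃ = ker (π : J₃ → S₃)` is infinite cyclic: it is generated
by the element `(s_{1,3} s_{1,2})³`, which has infinite order in `J₃`. -/
theorem pureCactus_three_infinite_cyclic
    (φ : CactusGroup 3 →* Equiv.Perm (Fin 3))
    (hφ : ∀ g : CactusGen 3, φ (cactusGen g) = segRev 3 g.1.1 g.1.2) :
    φ.ker = Subgroup.zpowers cactusLoop ∧ ¬ IsOfFinOrder cactusLoop := by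
  refine ⟨?_, not_isOfFinOrder_cactusLoop⟩
  set a : CactusGroup 3 := cactusGen ⟨(1, 3), by decide⟩
  set b : CactusGroup 3 := cactusGen ⟨(1, 2), by decide⟩
  have hloop : cactusLoop = (a * b) ^ 3 := rfl
  have hφa : φ a = segRev 3 1 3 := hφ _
  have hφab : φ (a * b) = segRev 3 1 3 * segRev 3 1 2 := by
    rw [map_mul]
    exact congrArg₂ (· * ·) (hφ _) (hφ _)
  have hcube : φ (a * b) ^ 3 = 1 := by rw [hφab]; decide
  have horder : orderOf (φ (a * b)) = 3 :=
    orderOf_eq_prime hcube (by rw [hφab]; decide)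
  have hsign : Equiv.Perm.sign (φ (a * b)) = 1 := by rw [hφab]; decide
  have hsign_a : Equiv.Perm.sign (φ a) = -1 := by rw [hφa]; decide
  apply le_antisymm
  · intro x hx
    rw [MonoidHom.mem_ker] at hx
    obtain ⟨k, rfl | rfl⟩ := exists_zpow_of_mem_closure_involutions
      (cactusGen_mul_self _) (cactusGen_mul_self _)
      (closure_cactusGen_three ▸ Subgroup.mem_top x)
    · change φ ((a * b) ^ k) = 1 at hx
      rw [map_zpow, ← orderOf_dvd_iff_zpow_eq_one, horder] at hx
      obtain ⟨m, rfl⟩ := hx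
      exact ⟨m, by rw [hloop, zpow_mul]; rfl⟩
    · change φ ((a * b) ^ k * a) = 1 at hx
      have := congrArg Equiv.Perm.sign hx
      rw [map_mul, map_mul, map_zpow, map_zpow, hsign, hsign_a, one_zpow, map_one] at this
      exact absurd this (by decide)
  · rw [Subgroup.zpowers_le, MonoidHom.mem_ker, hloop, map_pow, hcube]
end

section
/- For all nonnegative integers λ₁, λ₂, λ₃, ν, the associator map ψ(μ) = max(λ₁+λ₃, λ₂+ν) − μ restricts to a strictly order-reversing bijection from M_{(λ₁λ₂)λ₃}^ν onto M_{λ₁(λ₂λ₃)}^ν. -/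
/-- The set `M^{ν}` of highest weights `μ` indexing the occurrences of `L(ν)` in
`(L(λ₁) ⊗ L(λ₂)) ⊗ L(λ₃)` in the `sl₂` hive category:
`max(|λ₁−λ₂|, |ν−λ₃|) ≤ μ ≤ min(λ₁+λ₂, ν+λ₃)` with `μ ≡ λ₁+λ₂` and `μ ≡ ν+λ₃ (mod 2)`.
The set indexing the occurrences of `L(ν)` in `L(λ₁) ⊗ (L(λ₂) ⊗ L(λ₃))` is
`hiveSet l₂ l₃ l₁ v`. -/
def hiveSet (l₁ l₂ l₃ v : ℕ) : Set ℤ :=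
  {μ : ℤ | max |(l₁ : ℤ) - l₂| |(v : ℤ) - l₃| ≤ μ ∧ μ ≤ min ((l₁ : ℤ) + l₂) ((v : ℤ) + l₃) ∧
    μ ≡ (l₁ : ℤ) + l₂ [ZMOD 2] ∧ μ ≡ (v : ℤ) + l₃ [ZMOD 2]}

theorem mem_hiveSet_comm {l₁ l₂ l₃ v : ℕ} {μ : ℤ} :
    μ ∈ hiveSet l₁ l₂ l₃ v ↔ μ ∈ hiveSet l₂ l₁ l₃ v := by
  simp only [hiveSet, Set.mem_ofPred_eq, abs_sub_comm (l₁ : ℤ), add_comm (l₁ : ℤ)]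

theorem max_sub_mem_hiveSet {l₁ l₂ l₃ v : ℕ} {μ : ℤ} (h : μ ∈ hiveSet l₁ l₂ l₃ v) :
    max ((l₁ : ℤ) + l₃) ((l₂ : ℤ) + v) - μ ∈ hiveSet l₂ l₃ l₁ v := by
  simp only [hiveSet, Set.mem_ofPred_eq, max_le_iff, le_min_iff, abs_le, Int.ModEq] at h ⊢
  omega

/-- The associator `ψ(μ) = max(λ₁+λ₃, λ₂+ν) − μ` restricts to a strictly order-reversing
bijection from `M_{(λ₁λ₂)λ₃}^ν` onto `M_{λ₁(λ₂λ₃)}^ν`. -/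
theorem hive_associator_bijOn_antitone (l₁ l₂ l₃ v : ℕ) :
    Set.BijOn (fun μ : ℤ => max ((l₁ : ℤ) + l₃) ((l₂ : ℤ) + v) - μ)
      (hiveSet l₁ l₂ l₃ v) (hiveSet l₂ l₃ l₁ v) ∧
    ∀ μ₁ ∈ hiveSet l₁ l₂ l₃ v, ∀ μ₂ ∈ hiveSet l₁ l₂ l₃ v, μ₁ < μ₂ →
      max ((l₁ : ℤ) + l₃) ((l₂ : ℤ) + v) - μ₂ < max ((l₁ : ℤ) + l₃) ((l₂ : ℤ) + v) - μ₁ := by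
  refine ⟨⟨fun μ h => max_sub_mem_hiveSet h, sub_right_injective.injOn, fun μ h => ?_⟩,
    fun μ₁ _ μ₂ _ h => sub_lt_sub_left h _⟩
  refine ⟨_, mem_hiveSet_comm.1 (max_sub_mem_hiveSet (mem_hiveSet_comm.1 h)), ?_⟩
  simp only [add_comm (l₃ : ℤ), sub_sub_cancel]
end

section
/- For all nonnegative integers λ₁, λ₂, λ₃, ν, the finite sets M_{(λ₁λ₂)λ₃}^ν and M_{λ₁(λ₂λ₃)}^ν have the same cardinality; that is, the two polytopes indexing occurrences of L(ν) in the two bracketings have the same number of integer points. -/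
/-- The length of the interval cut out by the hive inequalities is symmetric in its arguments: it is
the minimum of `2x` and `a + b + c + d - 2x` over `x ∈ {a, b, c, d}`. -/
theorem min_add_sub_max_abs_sub_rotate (a b c d : ℤ) :
    min (a + b) (d + c) - max |a - b| |d - c| = min (b + c) (d + a) - max |b - c| |d - a| := by
  rcases abs_cases (a - b) with ⟨h₁, _⟩ | ⟨h₁, _⟩ <;>
  rcases abs_cases (d - c) with ⟨h₂, _⟩ | ⟨h₂, _⟩ <;>
  rcases abs_cases (b - c) with ⟨h₃, _⟩ | ⟨h₃, _⟩ <;>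
  rcases abs_cases (d - a) with ⟨h₄, _⟩ | ⟨h₄, _⟩ <;>
  rw [h₁, h₂, h₃, h₄] <;> omega

/-- When the sum of the arguments is even, the lower hive bound has the parity of `a + b`. -/
theorem max_abs_sub_emod_two {a b c d : ℤ} (h : (a + b + c + d) % 2 = 0) :
    max |a - b| |d - c| % 2 = (a + b) % 2 := by
  rcases abs_cases (a - b) with ⟨h₁, _⟩ | ⟨h₁, _⟩ <;>
  rcases abs_cases (d - c) with ⟨h₂, _⟩ | ⟨h₂, _⟩ <;>
  rw [h₁, h₂] <;> omega

/-- The two hive sets are translates of each other. -/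
theorem image_add_hiveSet (l₁ l₂ l₃ v : ℕ) :
    (fun μ : ℤ ↦ μ + (max |(l₂ : ℤ) - l₃| |(v : ℤ) - l₁| - max |(l₁ : ℤ) - l₂| |(v : ℤ) - l₃|)) ''
      hiveSet l₁ l₂ l₃ v = hiveSet l₂ l₃ l₁ v := by
  rw [Set.image_add_right]
  ext μ
  simp only [hiveSet, Set.mem_preimage, Set.mem_ofPred_eq, Int.ModEq]
  by_cases h : ((l₁ : ℤ) + l₂ + l₃ + v) % 2 = 0
  · have hlen := min_add_sub_max_abs_sub_rotate (l₁ : ℤ) l₂ l₃ v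
    have hpar₁ := max_abs_sub_emod_two h
    have hpar₂ := max_abs_sub_emod_two (a := l₂) (b := l₃) (c := l₁) (d := v) (by omega)
    generalize max |(l₁ : ℤ) - l₂| |(v : ℤ) - l₃| = m₁ at *
    generalize max |(l₂ : ℤ) - l₃| |(v : ℤ) - l₁| = m₂ at *
    generalize min ((l₁ : ℤ) + l₂) (v + l₃) = n₁ at *
    generalize min ((l₂ : ℤ) + l₃) (v + l₁) = n₂ at *
    omega
  · constructor <;> rintro ⟨-, -, h₁, h₂⟩ <;> omega

/-- The finite sets `M_{(λ₁λ₂)λ₃}^ν` and `M_{λ₁(λ₂λ₃)}^ν` have the same cardinality: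
the two polytopes indexing the occurrences of `L(ν)` in the two bracketings have the
same number of integer points. -/
theorem hive_sets_same_card (l₁ l₂ l₃ v : ℕ) :
    (hiveSet l₁ l₂ l₃ v).ncard = (hiveSet l₂ l₃ l₁ v).ncard := by
  rw [← image_add_hiveSet l₁ l₂ l₃ v, Set.ncard_image_of_injective _ (add_left_injective _)]
end
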